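/- Let X be a topological space with a Kuratowski partition F = {F_α : α < κ}, and let f, g ∈ FN(κ). Then the set {x ∈ X : f(x) = g(x)} has the Baire property in X. -/

import Mathlib

open Set

/-- A set has the Baire property iff it is the symmetric difference of an open set
and a meager set. -/
def HasBaireProperty {X : Type*} [TopologicalSpace X] (E : Set X) : Prop :=
  ∃ V M : Set X, IsOpen V ∧ IsMeagre M ∧ E = symmDiff V M

/-- An indexed (enumerated) Kuratowski partition `F = {F_α : α < κ}`: a partition of `X`
into (nonempty) meager sets such that the union of every subfamily has the Baire
property. -/
def IsKuratowskiFamily {X : Type*} {ι : Type*} [TopologicalSpace X] (F : ι → Set X) : Prop :=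
  (∀ i, IsMeagre (F i)) ∧ (∀ i, (F i).Nonempty) ∧ Pairwise (Function.onFun Disjoint F) ∧
    (⋃ i, F i) = Set.univ ∧ ∀ s : Set ι, HasBaireProperty (⋃ i ∈ s, F i)

/-- `f ∈ FN(κ)`: there is a family `𝒰_f` of pairwise disjoint open sets whose union is
dense in `X` such that `f` is constant on `F_α ∩ U` for every `α < κ` and every
`U ∈ 𝒰_f`. -/
def MemFN {X : Type*} {ι : Type*} [TopologicalSpace X] (F : ι → Set X) (f : X → ι) : Prop :=
  ∃ 𝒰 : Set (Set X), (∀ U ∈ 𝒰, IsOpen U) ∧ 𝒰.PairwiseDisjoint id ∧ Dense (⋃₀ 𝒰) ∧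
    ∀ i : ι, ∀ U ∈ 𝒰, ∀ x ∈ F i ∩ U, ∀ y ∈ F i ∩ U, f x = f y

/-- The union of pieces that are nowhere dense inside pairwise disjoint open sets is nowhere
dense. -/
lemma isNowhereDense_iUnion_inter {X J : Type*} [TopologicalSpace X] {W N : J → Set X}
    (hW : ∀ j, IsOpen (W j)) (hd : Pairwise (Function.onFun Disjoint W))
    (hN : ∀ j, IsNowhereDense (N j)) : IsNowhereDense (⋃ j, N j ∩ W j) := by
  rw [isNowhereDense_iff_forall_notMem_nhds]
  intro x hx hnhds
  obtain ⟨j, hxN, hxW⟩ := mem_iUnion.1 hx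
  refine isNowhereDense_iff_forall_notMem_nhds.1 (hN j) x hxN ?_
  filter_upwards [hnhds, (hW j).mem_nhds hxW] with y hy hyW
  refine closure_mono ?_ ((hW j).inter_closure ⟨hyW, hy⟩)
  rintro z ⟨hzW, hz⟩
  obtain ⟨k, hzN, hzk⟩ := mem_iUnion.1 hz
  obtain rfl : j = k := by
    by_contra hjk
    exact disjoint_left.1 (hd hjk) hzW hzk
  exact hzN

/-- A meagre set is covered by a sequence of nowhere dense sets. -/
lemma IsMeagre.exists_seq_isNowhereDense {X : Type*} [TopologicalSpace X] {M : Set X}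
    (hM : IsMeagre M) : ∃ N : ℕ → Set X, (∀ n, IsNowhereDense (N n)) ∧ M ⊆ ⋃ n, N n := by
  obtain ⟨S, hS, hc, hMS⟩ := isMeagre_iff_countable_union_isNowhereDense.1 hM
  obtain ⟨N, hN⟩ := (hc.insert ∅).exists_eq_range (insert_nonempty _ _)
  refine ⟨N, fun n => ?_, fun x hx => ?_⟩
  · have : N n ∈ insert ∅ S := hN ▸ mem_range_self n
    rcases this with h | h
    · rw [h]
      exact isNowhereDense_empty
    · exact hS _ h
  · obtain ⟨t, ht, hxt⟩ := hMS hx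
    have : t ∈ range N := hN ▸ mem_insert_of_mem _ ht
    obtain ⟨n, rfl⟩ := this
    exact mem_iUnion.2 ⟨n, hxt⟩

/-- The union of pieces that are meagre inside pairwise disjoint open sets is meagre. -/
lemma isMeagre_iUnion_inter {X J : Type*} [TopologicalSpace X] {W M : J → Set X}
    (hW : ∀ j, IsOpen (W j)) (hd : Pairwise (Function.onFun Disjoint W))
    (hM : ∀ j, IsMeagre (M j)) : IsMeagre (⋃ j, M j ∩ W j) := by
  choose N hN hMN using fun j => (hM j).exists_seq_isNowhereDense
  refine (isMeagre_iUnion fun n =>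
    (isNowhereDense_iUnion_inter hW hd fun j => hN j n).isMeagre).mono ?_
  refine iUnion_subset fun j x hx => ?_
  obtain ⟨n, hn⟩ := mem_iUnion.1 (hMN j hx.1)
  exact mem_iUnion.2 ⟨n, mem_iUnion.2 ⟨j, hn, hx.2⟩⟩

/-- A set has the Baire property if it agrees with sets having the Baire property on the members
of a pairwise disjoint family of open sets with dense union. -/
lemma hasBaireProperty_of_locally {X J : Type*} [TopologicalSpace X] {W B : J → Set X}
    {E : Set X} (hW : ∀ j, IsOpen (W j)) (hd : Pairwise (Function.onFun Disjoint W))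
    (hdense : Dense (⋃ j, W j)) (hB : ∀ j, HasBaireProperty (B j))
    (hE : ∀ j, ∀ x ∈ W j, x ∈ E ↔ x ∈ B j) : HasBaireProperty E := by
  choose V M hV hM hVM using hB
  set O : Set X := ⋃ j, V j ∩ W j with hO
  refine ⟨O, symmDiff O E, isOpen_iUnion fun j => (hV j).inter (hW j), ?_,
    (symmDiff_symmDiff_cancel_left O E).symm⟩
  have hcompl : IsMeagre (⋃ j, W j)ᶜ := by
    rw [IsMeagre, compl_compl]
    exact residual_of_dense_open (isOpen_iUnion hW) hdense
  refine (hcompl.union (isMeagre_iUnion_inter hW hd hM)).mono fun x hx => ?_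
  by_cases hxW : x ∈ ⋃ j, W j
  · obtain ⟨j, hj⟩ := mem_iUnion.1 hxW
    refine Or.inr (mem_iUnion.2 ⟨j, ?_, hj⟩)
    have hxO : x ∈ O ↔ x ∈ V j := by
      refine ⟨fun h => ?_, fun h => mem_iUnion.2 ⟨j, h, hj⟩⟩
      obtain ⟨k, hxV, hk⟩ := mem_iUnion.1 h
      obtain rfl : j = k := by
        by_contra hjk
        exact disjoint_left.1 (hd hjk) hj hk
      exact hxV
    have hxE := hE j x hj
    rw [hVM j, mem_symmDiff] at hxE
    rw [mem_symmDiff] at hx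
    tauto
  · exact Or.inl hxW

/-- If `F = {F_α : α < κ}` is a Kuratowski partition of `X` and
`f, g ∈ FN(κ)`, then `{x : f(x) = g(x)}` has the Baire property. -/
theorem baireProperty_eq_of_memFN {X : Type*} {ι : Type*} [TopologicalSpace X]
    [LinearOrder ι] (F : ι → Set X) (hF : IsKuratowskiFamily F)
    (f g : X → ι) (hf : MemFN F f) (hg : MemFN F g) :
    HasBaireProperty {x : X | f x = g x} := by
  obtain ⟨-, -, -, hcover, hBaire⟩ := hF
  obtain ⟨𝒰, h𝒰, h𝒰d, h𝒰dense, hfc⟩ := hf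
  obtain ⟨𝒱, h𝒱, h𝒱d, h𝒱dense, hgc⟩ := hg
  let W : 𝒰 × 𝒱 → Set X := fun p => p.1 ∩ p.2
  refine hasBaireProperty_of_locally (W := W)
    (B := fun p => ⋃ i ∈ {i | ∃ x ∈ F i ∩ W p, f x = g x}, F i)
    (fun p => (h𝒰 _ p.1.2).inter (h𝒱 _ p.2.2)) ?_ ?_ (fun p => hBaire _) ?_
  · intro p q hpq
    refine disjoint_left.2 fun x hp hq => hpq (Prod.ext (Subtype.ext ?_) (Subtype.ext ?_))
    · exact h𝒰d.elim_set p.1.2 q.1.2 x hp.1 hq.1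
    · exact h𝒱d.elim_set p.2.2 q.2.2 x hp.2 hq.2
  · refine (h𝒰dense.inter_of_isOpen_left h𝒱dense (isOpen_sUnion h𝒰)).mono ?_
    rintro x ⟨⟨U, hU, hxU⟩, V, hV, hxV⟩
    exact mem_iUnion.2 ⟨(⟨U, hU⟩, ⟨V, hV⟩), hxU, hxV⟩
  · intro p x hx
    constructor
    · intro hfg
      obtain ⟨i, hi⟩ := mem_iUnion.1 (hcover ▸ mem_univ x)
      exact mem_biUnion (x := i) ⟨x, ⟨hi, hx⟩, hfg⟩ hi
    · intro hxB
      obtain ⟨i, ⟨y, ⟨hyi, hyW⟩, hfg⟩, hi⟩ := mem_iUnion₂.1 hxB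
      exact (hfc i p.1 p.1.2 x ⟨hi, hx.1⟩ y ⟨hyi, hyW.1⟩).trans
        (hfg.trans (hgc i p.2 p.2.2 y ⟨hyi, hyW.2⟩ x ⟨hi, hx.2⟩))
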